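/- Let π : ℝᵈ → ℝⁿ be a surjective linear map, Q ⊆ ℝⁿ an additive subgroup, and I ⊆ {1,…,d} a set of n indices such that the restriction of π to V_I = span_ℝ{e_i : i ∈ I} is a linear isomorphism onto ℝⁿ. Let N_ℂ = {E(Z) : Z ∈ ℂᵈ, π_ℂ(Z) ∈ Q} act on ℂᵈ by componentwise multiplication, and let p_σ ∈ ℂᵈ be the point with (p_σ)_j = 0 for j ∈ I and (p_σ)_j = 1 for j ∉ I. Then the N_ℂ-orbit of p_σ is a fixed point of the induced (ℂ*)ᵈ-action on the orbit space: for every t ∈ (ℂ*)ᵈ there exists g ∈ N_ℂ (in fact g = E(W) with W ∈ ker(π_ℂ)) such that t·p_σ = g·p_σ. -/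

import Mathlib

/-- The componentwise exponential factor `e^{2πi z}`. -/
noncomputable def e2 (z : ℂ) : ℂ := Complex.exp (2 * (Real.pi : ℂ) * Complex.I * z)

/-- A linear map into `Fin n → ℂ` with the matrix of `π` agrees with `π` on real vectors. -/
theorem complexification_apply_ofReal {d n : ℕ} (π : (Fin d → ℝ) →ₗ[ℝ] (Fin n → ℝ))
    (πC : (Fin d → ℂ) →ₗ[ℂ] (Fin n → ℂ))
    (hπC : ∀ Z i, πC Z i = ∑ j, Z j * ((π (Pi.single j 1)) i : ℂ)) (u : Fin d → ℝ) :
    πC (fun j => (u j : ℂ)) = fun i => (π u i : ℂ) := by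
  ext i
  rw [hπC, LinearMap.pi_apply_eq_sum_univ π u]
  simp [Finset.sum_apply, ← Pi.single_apply, Pi.single_comm]

/-- Vectors in the span of the `e_i`, `i ∈ I`, vanish off `I`. -/
theorem apply_eq_zero_of_mem_span_single {d : ℕ} {I : Finset (Fin d)} {u : Fin d → ℝ}
    (hu : u ∈ Submodule.span ℝ ((fun i : Fin d => Pi.single i (1 : ℝ)) '' I))
    {j : Fin d} (hj : j ∉ I) : u j = 0 := by
  have hle : Submodule.span ℝ ((fun i : Fin d => (Pi.single i (1 : ℝ) : Fin d → ℝ)) '' I) ≤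
      LinearMap.ker (LinearMap.proj j : (Fin d → ℝ) →ₗ[ℝ] ℝ) := by
    rw [Submodule.span_le]
    rintro _ ⟨i, hi, rfl⟩
    have hji : j ≠ i := fun h => hj (h ▸ hi)
    simp [hji]
  exact hle hu

theorem e2_log_div {z : ℂ} (hz : z ≠ 0) :
    e2 (Complex.log z / (2 * (Real.pi : ℂ) * Complex.I)) = z := by
  rw [e2, mul_div_cancel₀ _ Complex.two_pi_I_ne_zero, Complex.exp_log hz]

/-- With `π`, `I`, `V_I` as usual and `p_σ` the point with
coordinates `0` on `I` and `1` off `I`, the `N_ℂ`-orbit of `p_σ` is a fixed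
point of the `(ℂ*)ᵈ`-action on the orbit space: every `t ∈ (ℂ*)ᵈ` moves `p_σ`
within its `N_ℂ`-orbit, indeed `t·p_σ = E(W)·p_σ` for some `W ∈ ker π_ℂ`. -/
theorem stmt13 (d n : ℕ) (π : (Fin d → ℝ) →ₗ[ℝ] (Fin n → ℝ))
    (hsurj : Function.Surjective π)
    (Q : AddSubgroup (Fin n → ℝ))
    (I : Finset (Fin d)) (hcard : I.card = n)
    (VI : Submodule ℝ (Fin d → ℝ))
    (hVI : VI = Submodule.span ℝ ((fun i : Fin d => Pi.single i (1 : ℝ)) '' I))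
    (hbij : Function.Bijective (π.comp VI.subtype))
    (πC : (Fin d → ℂ) →ₗ[ℂ] (Fin n → ℂ))
    (hπC : ∀ Z i, πC Z i = ∑ j, Z j * ((π (Pi.single j 1)) i : ℂ))
    (p : Fin d → ℂ)
    (hp : p = fun j => if j ∈ I then 0 else 1)
    (t : Fin d → ℂ) (ht : ∀ j, t j ≠ 0) :
    ∃ W : Fin d → ℂ, πC W = 0 ∧ ∀ j, t j * p j = e2 (W j) * p j := by
  subst hVI hp
  set Z : Fin d → ℂ := fun j => Complex.log (t j) / (2 * (Real.pi : ℂ) * Complex.I)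
  obtain ⟨⟨u, hu⟩, hπu⟩ := hbij.2 fun i => (πC Z i).re
  obtain ⟨⟨v, hv⟩, hπv⟩ := hbij.2 fun i => (πC Z i).im
  replace hπu : π u = fun i => (πC Z i).re := hπu
  replace hπv : π v = fun i => (πC Z i).im := hπv
  refine ⟨Z - ((fun j => (u j : ℂ)) + Complex.I • fun j => (v j : ℂ)), ?_, fun j => ?_⟩
  · rw [map_sub, map_add, map_smul, complexification_apply_ofReal π πC hπC,
      complexification_apply_ofReal π πC hπC, hπu, hπv, sub_eq_zero]
    ext i
    simp [mul_comm Complex.I, Complex.re_add_im]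
  · by_cases hj : j ∈ I
    · simp [hj]
    · simp [hj, apply_eq_zero_of_mem_span_single hu hj,
        apply_eq_zero_of_mem_span_single hv hj, Z, e2_log_div (ht j)]
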